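/- arXiv:2602.20948 — 8 statements merged into one kernel-verified Lean document; each statement's English description precedes it below -/
import Mathlib

section
/- Let A ∈ ℝ^{n×n} be symmetric. Suppose Q_m ∈ ℝ^{n×m} and q ∈ ℝ^n are such that the matrix [Q_m, q] has orthonormal columns, and suppose there exist a symmetric matrix T_m ∈ ℝ^{m×m}, a vector b ∈ ℝ^m, and a matrix F ∈ ℝ^{n×m} such that A·Q_m = Q_m·T_m + q·bᵀ + F, Q_mᵀ·F = 0 and qᵀ·F = 0. Let V ∈ ℝ^{m×ℓ} with ℓ < m satisfy Vᵀ·V = I_ℓ, and define Q̃ = Q_m·V, T̃ = Vᵀ·T_m·V, b̃ = Vᵀ·b, and F̃ = Q_m·(I_m − V·Vᵀ)·T_m·V + F·V. Then A·Q̃ = Q̃·T̃ + q·b̃ᵀ + F̃, Q̃ᵀ·F̃ = 0, and qᵀ·F̃ = 0. -/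
open Matrix

/-- Theorem 2.1, compression of a Krylov-like decomposition.
If `A·Q = Q·T + q·bᵀ + F` is a Krylov-like decomposition of the symmetric matrix `A`
(`[Q, q]` has orthonormal columns, `T` symmetric, `[Q, q]ᵀ·F = 0`), and `V` has
orthonormal columns, then setting `Q̃ = Q·V`, `T̃ = Vᵀ·T·V`, `b̃ = Vᵀ·b` and
`F̃ = Q·(I − V·Vᵀ)·T·V + F·V` gives again a Krylov-like decomposition
`A·Q̃ = Q̃·T̃ + q·b̃ᵀ + F̃` with `Q̃ᵀ·F̃ = 0` and `qᵀ·F̃ = 0`. -/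
theorem compression_of_krylov_like_decomposition
    {n m ℓ : ℕ} (hℓm : ℓ < m)
    (A : Matrix (Fin n) (Fin n) ℝ) (hA : Aᵀ = A)
    (Q : Matrix (Fin n) (Fin m) ℝ) (q : Matrix (Fin n) (Fin 1) ℝ)
    (hQQ : Qᵀ * Q = 1) (hqq : qᵀ * q = 1) (hQq : Qᵀ * q = 0)
    (T : Matrix (Fin m) (Fin m) ℝ) (hT : Tᵀ = T)
    (b : Matrix (Fin m) (Fin 1) ℝ) (F : Matrix (Fin n) (Fin m) ℝ)
    (hdec : A * Q = Q * T + q * bᵀ + F)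
    (hQF : Qᵀ * F = 0) (hqF : qᵀ * F = 0)
    (V : Matrix (Fin m) (Fin ℓ) ℝ) (hV : Vᵀ * V = 1) :
    A * (Q * V) = (Q * V) * (Vᵀ * T * V) + q * (Vᵀ * b)ᵀ +
        (Q * ((1 - V * Vᵀ) * T * V) + F * V) ∧
    (Q * V)ᵀ * (Q * ((1 - V * Vᵀ) * T * V) + F * V) = 0 ∧
    qᵀ * (Q * ((1 - V * Vᵀ) * T * V) + F * V) = 0 := by
  have hqQ : qᵀ * Q = 0 := by
    have h := congrArg Matrix.transpose hQq
    simpa [Matrix.transpose_mul] using h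
  have hP : Vᵀ * ((1 - V * Vᵀ) * T * V) = 0 := by
    have h : Vᵀ * (1 - V * Vᵀ) = 0 := by
      rw [Matrix.mul_sub, ← Matrix.mul_assoc, hV, Matrix.mul_one, Matrix.one_mul, sub_self]
    rw [← Matrix.mul_assoc, ← Matrix.mul_assoc, h, Matrix.zero_mul, Matrix.zero_mul]
  refine ⟨?_, ?_, ?_⟩
  · rw [← Matrix.mul_assoc A, hdec]
    simp only [Matrix.add_mul, Matrix.sub_mul, Matrix.mul_sub, Matrix.transpose_mul,
      Matrix.transpose_transpose, Matrix.mul_assoc, Matrix.one_mul]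
    abel
  · rw [Matrix.transpose_mul, Matrix.mul_assoc, Matrix.mul_add, ← Matrix.mul_assoc Qᵀ Q,
      ← Matrix.mul_assoc Qᵀ F, hQQ, hQF, Matrix.one_mul, Matrix.zero_mul, add_zero, hP]
  · rw [Matrix.mul_add, ← Matrix.mul_assoc qᵀ Q, ← Matrix.mul_assoc qᵀ F, hqQ, hqF,
      Matrix.zero_mul, Matrix.zero_mul, add_zero]
end

section
/- Let A ∈ ℝ^{n×n} be symmetric. Suppose Q_m ∈ ℝ^{n×m} and q ∈ ℝ^n are such that [Q_m, q] has orthonormal columns, and suppose A·Q_m = Q_m·T_m + q·bᵀ + F with T_m symmetric, Q_mᵀ·F = 0 and qᵀ·F = 0. Let V ∈ ℝ^{m×ℓ} satisfy Vᵀ·V = I_ℓ and V·Vᵀ·b = b, and set Q̃ = Q_m·V. Then (I − Q_m·Q_mᵀ − q·qᵀ)·A·q = (I − Q̃·Q̃ᵀ − q·qᵀ)·A·q; consequently, the next Lanczos vector obtained by orthogonalizing A·q against [Q_m, q] coincides (up to sign and normalization) with the vector obtained by orthogonalizing A·q against [Q̃, q]. -/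
open Matrix

/-- Proposition 2.2, preservation of the next Lanczos vector.
Given a Krylov-like decomposition `A·Q = Q·T + q·bᵀ + F` of a symmetric matrix `A`,
and `V` with orthonormal columns satisfying `V·Vᵀ·b = b`, the orthogonal projection of
`A·q` onto the complement of `[Q, q]` coincides with the projection onto the complement
of `[Q·V, q]`; hence the next Lanczos vector is preserved by the compression. -/
theorem compression_preserves_next_lanczos_vector
    {n m ℓ : ℕ}
    (A : Matrix (Fin n) (Fin n) ℝ) (hA : Aᵀ = A)
    (Q : Matrix (Fin n) (Fin m) ℝ) (q : Matrix (Fin n) (Fin 1) ℝ)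
    (hQQ : Qᵀ * Q = 1) (hqq : qᵀ * q = 1) (hQq : Qᵀ * q = 0)
    (T : Matrix (Fin m) (Fin m) ℝ) (hT : Tᵀ = T)
    (b : Matrix (Fin m) (Fin 1) ℝ) (F : Matrix (Fin n) (Fin m) ℝ)
    (hdec : A * Q = Q * T + q * bᵀ + F)
    (hQF : Qᵀ * F = 0) (hqF : qᵀ * F = 0)
    (V : Matrix (Fin m) (Fin ℓ) ℝ) (hV : Vᵀ * V = 1)
    (hVb : V * (Vᵀ * b) = b) :
    (1 - Q * Qᵀ - q * qᵀ) * (A * q) =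
      (1 - (Q * V) * (Q * V)ᵀ - q * qᵀ) * (A * q) := by
  have hFq : Fᵀ * q = 0 := by
    have h := congrArg Matrix.transpose hqF
    simpa [Matrix.transpose_mul] using h
  have key : Qᵀ * (A * q) = b := by
    have h := congrArg (fun M => Mᵀ * q) hdec
    simpa [Matrix.transpose_mul, Matrix.transpose_add, Matrix.add_mul, Matrix.mul_assoc,
      hA, hQq, hqq, hFq] using h
  have e : (Q * V) * (Q * V)ᵀ * (A * q) = Q * Qᵀ * (A * q) := by
    rw [Matrix.transpose_mul]
    simp only [Matrix.mul_assoc]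
    rw [key, hVb]
  rw [Matrix.sub_mul, Matrix.sub_mul, Matrix.sub_mul, Matrix.sub_mul, e]
end

section
/- Let Q̂ ∈ ℝ^{n×m} satisfy ‖Q̂ᵀ·Q̂ − I‖ ≤ ε for some 0 ≤ ε < 1 (spectral norm). Then Q̂ᵀ·Q̂ is symmetric positive definite, the matrix Q := Q̂·(Q̂ᵀ·Q̂)^{−1/2} satisfies Qᵀ·Q = I, and ‖Q − Q̂‖ ≤ ε. -/
open Matrix

/-- The spectral (operator 2-) norm of a real matrix. -/
noncomputable def specNorm {α β : Type*} [Fintype α] [Fintype β] [DecidableEq β]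
    (A : Matrix α β ℝ) : ℝ :=
  ‖LinearMap.toContinuousLinearMap (Matrix.toEuclideanLin A)‖

theorem specNorm_le_iff_dot {n m : ℕ} (A : Matrix (Fin n) (Fin m) ℝ) (ε : ℝ) (hε : 0 ≤ ε) :
    specNorm A ≤ ε ↔ ∀ x : Fin m → ℝ, (A *ᵥ x) ⬝ᵥ (A *ᵥ x) ≤ ε ^ 2 * (x ⬝ᵥ x) := by
  have key : ∀ {k : ℕ} (y : Fin k → ℝ), ‖WithLp.toLp 2 y‖ ^ 2 = y ⬝ᵥ y := by
    intro k y
    rw [EuclideanSpace.norm_sq_eq]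
    simp [dotProduct, sq]
  unfold specNorm
  rw [ContinuousLinearMap.opNorm_le_iff hε]
  constructor
  · intro h x
    have h1 : ‖WithLp.toLp 2 (A *ᵥ x)‖ ≤ ε * ‖WithLp.toLp 2 x‖ := h (WithLp.toLp 2 x)
    rw [← key, ← key, ← mul_pow]
    exact pow_le_pow_left₀ (norm_nonneg _) h1 2
  · intro h x
    have h1 := h x.ofLp
    rw [← key, ← key, ← mul_pow] at h1
    exact le_of_sq_le_sq h1 (by positivity)

/-- orthogonal polar factor of a numerically orthonormal basis.
If `‖Q̂ᵀ·Q̂ − I‖ ≤ ε < 1` then `Q̂ᵀ·Q̂` is symmetric positive definite, and for its unique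
symmetric positive definite square root `S` (i.e. any `S` with `S.PosDef` and
`S·S = Q̂ᵀ·Q̂`), the matrix `Q := Q̂·S⁻¹ = Q̂·(Q̂ᵀ·Q̂)^{-1/2}` has exactly orthonormal
columns and satisfies `‖Q − Q̂‖ ≤ ε`. -/
theorem orthonormal_polar_factor_close
    {n m : ℕ}
    (Qh : Matrix (Fin n) (Fin m) ℝ)
    (ε : ℝ) (hε0 : 0 ≤ ε) (hε1 : ε < 1)
    (h : specNorm (Qhᵀ * Qh - 1) ≤ ε) :
    (Qhᵀ * Qh).PosDef ∧
    ∀ S : Matrix (Fin m) (Fin m) ℝ, S.PosDef → S * S = Qhᵀ * Qh →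
      (Qh * S⁻¹)ᵀ * (Qh * S⁻¹) = 1 ∧ specNorm (Qh * S⁻¹ - Qh) ≤ ε := by
  rw [specNorm_le_iff_dot _ _ hε0] at h
  have hpos : ∀ {k : ℕ} (y : Fin k → ℝ), 0 ≤ y ⬝ᵥ y := fun y =>
    Finset.sum_nonneg fun i _ => mul_self_nonneg (y i)
  constructor
  · have hinj : Function.Injective Qh.mulVec := by
      intro a b hab
      have h0 : Qh *ᵥ (a - b) = 0 := by
        rw [Matrix.mulVec_sub]; exact sub_eq_zero.2 hab
      have h1 := h (a - b)
      rw [Matrix.sub_mulVec, ← Matrix.mulVec_mulVec, h0, Matrix.mulVec_zero, Matrix.one_mulVec,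
        zero_sub, neg_dotProduct_neg] at h1
      have h2 : (a - b) ⬝ᵥ (a - b) = 0 := by
        have := hpos (a - b)
        have h3 : ε ^ 2 < 1 := by nlinarith
        nlinarith
      exact sub_eq_zero.1 (dotProduct_self_eq_zero.1 h2)
    have := Matrix.PosDef.conjTranspose_mul_self Qh hinj
    rwa [Matrix.conjTranspose_eq_transpose_of_trivial] at this
  · intro S hS hSS
    have hdet : IsUnit S.det := hS.det_pos.ne'.isUnit
    have hST : Sᵀ = S := by
      have := hS.isHermitian.eq
      rwa [Matrix.conjTranspose_eq_transpose_of_trivial] at this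
    have horth : (Qh * S⁻¹)ᵀ * (Qh * S⁻¹) = 1 := by
      rw [Matrix.transpose_mul, Matrix.transpose_nonsing_inv, hST, Matrix.mul_assoc,
        ← Matrix.mul_assoc Qhᵀ, ← hSS, Matrix.mul_assoc S, Matrix.mul_nonsing_inv _ hdet,
        Matrix.mul_one, Matrix.nonsing_inv_mul _ hdet]
    refine ⟨horth, ?_⟩
    rw [specNorm_le_iff_dot _ _ hε0]
    intro x
    refine le_trans ?_ (h x)
    rw [← hSS]
    have e1 : Qh * S⁻¹ - Qh = (Qh * S⁻¹) * (1 - S) := by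
      rw [Matrix.mul_sub, Matrix.mul_one, Matrix.mul_assoc Qh, Matrix.nonsing_inv_mul _ hdet,
        Matrix.mul_one]
    have e2 : S * S - 1 = -((S + 1) * (1 - S)) := by noncomm_ring
    rw [e1, e2, Matrix.neg_mulVec, neg_dotProduct_neg, ← Matrix.mulVec_mulVec x (Qh * S⁻¹) (1 - S),
      ← Matrix.mulVec_mulVec x (S + 1) (1 - S)]
    generalize (1 - S) *ᵥ x = y
    have h1 : ((Qh * S⁻¹) *ᵥ y) ⬝ᵥ ((Qh * S⁻¹) *ᵥ y) = y ⬝ᵥ y := by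
      rw [Matrix.dotProduct_mulVec, Matrix.vecMul_mulVec, horth, ← Matrix.dotProduct_mulVec]
      simp
    rw [h1, Matrix.add_mulVec, Matrix.one_mulVec, add_dotProduct, dotProduct_add, dotProduct_add,
      dotProduct_comm (S *ᵥ y) y]
    have h2 : 0 ≤ y ⬝ᵥ (S *ᵥ y) := by
      simpa using hS.posSemidef.dotProduct_mulVec_nonneg y
    have h3 := hpos (S *ᵥ y)
    linarith
end

section
/- Let T ∈ ℝ^{n×n} be symmetric with eigenvalues μ_1 ≤ … ≤ μ_n, and let W_k = [w_1, …, w_k] ∈ ℝ^{n×k} have orthonormal columns with T·w_i = μ_i·w_i for i = 1, …, k. Let X ∈ ℝ^{n×k} satisfy ‖X − W_k‖ ≤ ε for some 0 ≤ ε < 1 (spectral norm). Then Xᵀ·X is invertible, and the Rayleigh quotient R_T(X) := Tr((Xᵀ·X)⁻¹·(Xᵀ·T·X)) satisfies R_T(X) − (μ_1 + … + μ_k) ≤ k·(μ_n − μ_1)·ε². -/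
open Matrix

lemma specNorm_dot {n k : ℕ} (E : Matrix (Fin n) (Fin k) ℝ) (ε : ℝ) 
    (hE : specNorm E ≤ ε) (v : Fin k → ℝ) :
    (E *ᵥ v) ⬝ᵥ (E *ᵥ v) ≤ ε ^ 2 * (v ⬝ᵥ v) := by
  have h := (LinearMap.toContinuousLinearMap (Matrix.toEuclideanLin E)).le_of_opNorm_le hE
    (WithLp.toLp 2 v)
  have h2 := pow_le_pow_left₀ (norm_nonneg _) h 2
  rw [mul_pow, EuclideanSpace.norm_sq_eq, EuclideanSpace.norm_sq_eq] at h2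
  simpa [dotProduct, sq, Matrix.toLpLin_apply] using h2

/-- Lemma 3.1, Rayleigh quotient at a nearly orthonormal matrix.
`T` is symmetric with sorted eigenvalues `μ` (orthonormally diagonalized by `U`), the
columns of `W` are orthonormal eigenvectors for the `k` smallest eigenvalues, and
`‖X − W‖ ≤ ε < 1`.  Then `Xᵀ·X` is invertible and the Rayleigh quotient
`R_T(X) = Tr((Xᵀ·X)⁻¹·(Xᵀ·T·X))` exceeds `μ_1 + ⋯ + μ_k` by at most
`k·(μ_n − μ_1)·ε²`. -/
theorem rayleigh_quotient_nearly_orthonormal_bound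
    {n k : ℕ} (hn : 0 < n) (hk : k ≤ n)
    (T : Matrix (Fin n) (Fin n) ℝ) (hT : Tᵀ = T)
    (μ : Fin n → ℝ) (hμ : Monotone μ)
    (U : Matrix (Fin n) (Fin n) ℝ) (hU : Uᵀ * U = 1)
    (hTdiag : T = U * Matrix.diagonal μ * Uᵀ)
    (W : Matrix (Fin n) (Fin k) ℝ) (hW : Wᵀ * W = 1)
    (hTW : T * W = W * Matrix.diagonal (fun i : Fin k => μ (Fin.castLE hk i)))
    (X : Matrix (Fin n) (Fin k) ℝ)
    (ε : ℝ) (hε0 : 0 ≤ ε) (hε1 : ε < 1)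
    (hX : specNorm (X - W) ≤ ε) :
    IsUnit (Xᵀ * X) ∧
    Matrix.trace ((Xᵀ * X)⁻¹ * (Xᵀ * T * X)) - ∑ i : Fin k, μ (Fin.castLE hk i)
      ≤ (k : ℝ) * (μ ⟨n - 1, by omega⟩ - μ ⟨0, hn⟩) * ε ^ 2 := by
  have hE := specNorm_dot (X - W) ε hX
  have hunit : IsUnit (Xᵀ * X) := by
    rw [← Matrix.mulVec_injective_iff_isUnit]
    have key : ∀ v : Fin k → ℝ, (Xᵀ * X) *ᵥ v = 0 → v = 0 := by
      intro v hv
      have h1 : X *ᵥ v = 0 := by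
        rw [← dotProduct_self_eq_zero, dotProduct_mulVec, vecMul_mulVec, ← mulVec_transpose]
        simp [hv]
      have h2 : (W *ᵥ v) ⬝ᵥ (W *ᵥ v) = v ⬝ᵥ v := by
        rw [dotProduct_mulVec, vecMul_mulVec, hW]
        simp
      have h3 := hE v
      rw [sub_mulVec, h1, zero_sub, neg_dotProduct_neg, h2] at h3
      have h4 : 0 ≤ v ⬝ᵥ v := by
        simpa [dotProduct] using Finset.sum_nonneg (fun i _ => mul_self_nonneg (v i))
      rw [← dotProduct_self_eq_zero]
      have h5 : ε ^ 2 < 1 := by nlinarith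
      nlinarith
    intro a b hab
    have := key (a - b) (by rw [mulVec_sub]; exact sub_eq_zero.mpr hab)
    exact sub_eq_zero.mp this
  refine ⟨hunit, ?_⟩
  have hdet : IsUnit (Xᵀ * X).det := (Matrix.isUnit_iff_isUnit_det _).mp hunit
  obtain ⟨P, hP⟩ : ∃ P, P = X * (Xᵀ * X)⁻¹ * Xᵀ := ⟨_, rfl⟩
  have hPT : Pᵀ = P := by
    rw [hP]
    simp [Matrix.transpose_mul, Matrix.transpose_nonsing_inv, Matrix.mul_assoc]
  have hPX : P * X = X := by
    rw [hP, Matrix.mul_assoc, Matrix.mul_assoc, Matrix.nonsing_inv_mul _ hdet, Matrix.mul_one]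
  have hPP : P * P = P := by
    conv_lhs => rw [hP, ← Matrix.mul_assoc, ← Matrix.mul_assoc, ← hP, hPX, ← hP]
  have hXP : Xᵀ * P = Xᵀ := by
    have := congrArg Matrix.transpose hPX
    rwa [Matrix.transpose_mul, hPT] at this
  have htrP : P.trace = k := by
    rw [hP, Matrix.mul_assoc, Matrix.trace_mul_comm, Matrix.mul_assoc,
      Matrix.nonsing_inv_mul _ hdet]
    simp
  have hR : Matrix.trace ((Xᵀ * X)⁻¹ * (Xᵀ * T * X)) = (P * T).trace := by
    rw [hP, ← Matrix.mul_assoc, Matrix.trace_mul_comm]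
    simp only [Matrix.mul_assoc]
  obtain ⟨m, hm⟩ : ∃ m, m = μ ⟨n - 1, by omega⟩ := ⟨_, rfl⟩
  have hmle : ∀ i, μ i ≤ m := fun i => by
    rw [hm]; apply hμ; rw [Fin.le_def]; have := i.2; simp only; omega
  have h0le : ∀ i, μ ⟨0, hn⟩ ≤ μ i := fun i => by
    apply hμ; rw [Fin.le_def]; simp
  rw [← hm]
  obtain ⟨M, hM⟩ : ∃ M : Matrix (Fin n) (Fin n) ℝ, M = m • 1 - T := ⟨_, rfl⟩
  obtain ⟨d, hd⟩ : ∃ d : Fin k → ℝ, d = fun i => m - μ (Fin.castLE hk i) := ⟨_, rfl⟩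
  have hMT : Mᵀ = M := by rw [hM]; simp [hT]
  have hMpsd : M.PosSemidef := by
    have hU' : U * Uᵀ = 1 := mul_eq_one_comm.mp hU
    have : M = U * Matrix.diagonal (fun i => m - μ i) * Uᴴ := by
      have h1 : Matrix.diagonal (fun i => m - μ i) = m • 1 - Matrix.diagonal μ := by
        ext i j
        by_cases h : i = j
        · subst h; simp
        · simp [h]
      rw [h1, hM, hTdiag, Matrix.conjTranspose_eq_transpose_of_trivial, Matrix.mul_sub,
        Matrix.sub_mul]
      simp [hU']
    rw [this]
    apply Matrix.PosSemidef.mul_mul_conjTranspose_same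
    apply Matrix.PosSemidef.diagonal
    intro i
    simpa using hmle i
  have hMW : M * W = W * Matrix.diagonal d := by
    have h1 : Matrix.diagonal d
        = m • 1 - Matrix.diagonal (fun i : Fin k => μ (Fin.castLE hk i)) := by
      ext i j
      by_cases h : i = j
      · subst h; simp [hd]
      · simp [h]
    rw [h1, hM, Matrix.sub_mul, Matrix.mul_sub, hTW]
    simp
  have hWM : Wᵀ * M = Matrix.diagonal d * Wᵀ := by
    have := congrArg Matrix.transpose hMW
    rwa [Matrix.transpose_mul, Matrix.transpose_mul, hMT, Matrix.diagonal_transpose] at this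
  have hN : (1 - W * Wᵀ) * M * (1 - W * Wᵀ) = M - W * Matrix.diagonal d * Wᵀ := by
    have e1 : (1 - W * Wᵀ) * M = M - W * Matrix.diagonal d * Wᵀ := by
      rw [Matrix.sub_mul, Matrix.one_mul, Matrix.mul_assoc, hWM, Matrix.mul_assoc]
    have e2 : Wᵀ * (W * Wᵀ) = Wᵀ := by rw [← Matrix.mul_assoc, hW, Matrix.one_mul]
    rw [e1, Matrix.mul_sub, Matrix.mul_one, Matrix.sub_mul, ← Matrix.mul_assoc M, hMW,
      Matrix.mul_assoc _ Wᵀ, e2, sub_self, sub_zero]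
  have htrN : 0 ≤ (P * (M - W * Matrix.diagonal d * Wᵀ)).trace := by
    have h1 := (hMpsd.mul_mul_conjTranspose_same (P * (1 - W * Wᵀ))).trace_nonneg
    have h2 : P * (1 - W * Wᵀ) * M * (P * (1 - W * Wᵀ))ᴴ
        = P * (M - W * Matrix.diagonal d * Wᵀ) * P := by
      rw [← hN, Matrix.conjTranspose_eq_transpose_of_trivial, Matrix.transpose_mul, hPT]
      simp [Matrix.mul_assoc]
    rw [h2, Matrix.trace_mul_comm, ← Matrix.mul_assoc, hPP] at h1
    exact h1
  have htrD : (P * (W * Matrix.diagonal d * Wᵀ)).trace = ∑ i, (Wᵀ * P * W) i i * d i := by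
    rw [← Matrix.mul_assoc, Matrix.trace_mul_comm, ← Matrix.mul_assoc, ← Matrix.mul_assoc]
    simp [Matrix.trace, Matrix.mul_diagonal]
  have htrM : (P * M).trace = k * m - (P * T).trace := by
    rw [hM, Matrix.mul_sub, Matrix.trace_sub]
    simp [htrP, mul_comm]
  have hc : ∀ i, 1 - (Wᵀ * P * W) i i ≤ ε ^ 2 := by
    intro i
    have e1 : 1 - Wᵀ * P * W = (X - W)ᵀ * (X - W) - (P * (X - W))ᵀ * (P * (X - W)) := by
      have : (P * (X - W))ᵀ * (P * (X - W)) = (X - W)ᵀ * P * (X - W) := by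
        rw [Matrix.transpose_mul, hPT, Matrix.mul_assoc, ← Matrix.mul_assoc P, hPP,
          Matrix.mul_assoc]
      rw [this]
      simp only [Matrix.transpose_sub, Matrix.sub_mul, Matrix.mul_sub, hXP, hW]
      rw [Matrix.mul_assoc Wᵀ P X, hPX]
      abel
    have e2 := congrFun (congrFun e1 i) i
    rw [Matrix.sub_apply, Matrix.sub_apply, Matrix.one_apply_eq] at e2
    rw [e2]
    have e3 : 0 ≤ ((P * (X - W))ᵀ * (P * (X - W))) i i := by
      rw [Matrix.mul_apply]
      exact Finset.sum_nonneg (fun j _ => mul_self_nonneg _)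
    have e4 : ((X - W)ᵀ * (X - W)) i i ≤ ε ^ 2 := by
      have := hE (Pi.single i 1)
      rw [Matrix.mulVec_single_one] at this
      simpa [Matrix.mul_apply, dotProduct, Matrix.col_apply, Pi.single_apply] using this
    linarith
  rw [Matrix.mul_sub, Matrix.trace_sub, htrD, htrM] at htrN
  have hsum : ∑ i, d i = k * m - ∑ i : Fin k, μ (Fin.castLE hk i) := by
    simp [hd, Finset.sum_sub_distrib]
  have hfin : ∑ i, d i * (1 - (Wᵀ * P * W) i i) ≤ ∑ _i : Fin k, (m - μ ⟨0, hn⟩) * ε ^ 2 := by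
    apply Finset.sum_le_sum
    intro i _
    have h1 : 0 ≤ d i := by rw [hd]; simpa using hmle _
    have h2 : d i ≤ m - μ ⟨0, hn⟩ := by
      rw [hd]
      exact sub_le_sub_left (h0le _) m
    calc d i * (1 - (Wᵀ * P * W) i i) ≤ d i * ε ^ 2 := mul_le_mul_of_nonneg_left (hc i) h1
      _ ≤ _ := mul_le_mul_of_nonneg_right h2 (sq_nonneg ε)
  have hexp : ∑ i, d i * (1 - (Wᵀ * P * W) i i) = ∑ i, d i - ∑ i, (Wᵀ * P * W) i i * d i := by
    rw [← Finset.sum_sub_distrib]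
    exact Finset.sum_congr rfl (fun i _ => by ring)
  rw [hexp, Finset.sum_const, Finset.card_univ, Fintype.card_fin, nsmul_eq_mul] at hfin
  rw [hR]
  linarith
end

section
/- Let Y ∈ ℝ^{k×k}, Z ∈ ℝ^{p×k} and 0 ≤ ε < 1 be such that ‖(Y − I)·y‖² + ‖Z·y‖² ≤ ε²·‖y‖² for every y ∈ ℝ^k (Euclidean norms). Then Y is invertible and ‖Z·Y⁻¹‖² ≤ ε²/(1 − ε²), where ‖·‖ denotes the spectral norm. -/
open Matrix

/-- key estimate in the nonorthonormal Rayleigh quotient lemma.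
If `‖(Y − I)·y‖² + ‖Z·y‖² ≤ ε²·‖y‖²` (squared Euclidean norms) for every vector `y`,
with `0 ≤ ε < 1`, then `Y` is invertible and `‖Z·Y⁻¹‖² ≤ ε²/(1 − ε²)` in the spectral
norm. -/
theorem perturbed_identity_invertible_bound
    {k p : ℕ}
    (Y : Matrix (Fin k) (Fin k) ℝ) (Z : Matrix (Fin p) (Fin k) ℝ)
    (ε : ℝ) (hε0 : 0 ≤ ε) (hε1 : ε < 1)
    (h : ∀ y : Fin k → ℝ,
        (∑ i, ((Y - 1).mulVec y i) ^ 2) + (∑ i, (Z.mulVec y i) ^ 2)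
          ≤ ε ^ 2 * ∑ i, (y i) ^ 2) :
    IsUnit Y ∧ specNorm (Z * Y⁻¹) ^ 2 ≤ ε ^ 2 / (1 - ε ^ 2) := by
  have he : 0 < 1 - ε ^ 2 := by nlinarith
  have hd : ∀ (y : Fin k → ℝ) (i : Fin k), (Y - 1).mulVec y i = Y.mulVec y i - y i := by
    intro y i
    rw [Matrix.sub_mulVec, Matrix.one_mulVec, Pi.sub_apply]
  have key : ∀ y : Fin k → ℝ, (1 - ε ^ 2) * ∑ i, (Z.mulVec y i) ^ 2
      ≤ ε ^ 2 * ∑ i, (Y.mulVec y i) ^ 2 := by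
    intro y
    have h1 := h y
    have h2 : 0 ≤ ∑ i, ((Y - 1).mulVec y i + ε ^ 2 * y i) ^ 2 :=
      Finset.sum_nonneg fun i _ => sq_nonneg _
    have h3 : ∑ i, ((Y - 1).mulVec y i + ε ^ 2 * y i) ^ 2 =
        ε ^ 2 * ∑ i, (Y.mulVec y i) ^ 2 -
        (1 - ε ^ 2) * (ε ^ 2 * ∑ i, (y i) ^ 2 - ∑ i, ((Y - 1).mulVec y i) ^ 2) := by
      simp only [Finset.mul_sum, ← Finset.sum_sub_distrib]
      refine Finset.sum_congr rfl fun i _ => ?_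
      rw [hd]
      ring
    have h4 := mul_le_mul_of_nonneg_left h1 he.le
    linarith
  have hU : IsUnit Y := by
    rw [← Matrix.mulVec_injective_iff_isUnit]
    refine (injective_iff_map_eq_zero Y.mulVecLin).2 fun y hy => ?_
    have hy' : Y.mulVec y = 0 := hy
    have h1 := h y
    simp only [hd, hy', Pi.zero_apply, zero_sub, neg_sq] at h1
    have h2 : 0 ≤ ∑ i, (Z.mulVec y i) ^ 2 := Finset.sum_nonneg fun i _ => sq_nonneg _
    have h0 : 0 ≤ ∑ i, (y i) ^ 2 := Finset.sum_nonneg fun i _ => sq_nonneg _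
    have h3 : ∑ i, (y i) ^ 2 = 0 := by nlinarith
    rw [Finset.sum_eq_zero_iff_of_nonneg fun i _ => sq_nonneg _] at h3
    ext i
    simpa using h3 i (Finset.mem_univ i)
  refine ⟨hU, ?_⟩
  have hq : 0 ≤ ε ^ 2 / (1 - ε ^ 2) := by positivity
  have hb : specNorm (Z * Y⁻¹) ≤ Real.sqrt (ε ^ 2 / (1 - ε ^ 2)) := by
    refine ContinuousLinearMap.opNorm_le_bound _ (Real.sqrt_nonneg _) fun x => ?_
    have h1 := key (Y⁻¹.mulVec x.ofLp)
    rw [Matrix.mulVec_mulVec, Matrix.mulVec_mulVec,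
      Matrix.mul_nonsing_inv _ ((Matrix.isUnit_iff_isUnit_det _).1 hU), Matrix.one_mulVec] at h1
    rw [EuclideanSpace.norm_eq, EuclideanSpace.norm_eq, ← Real.sqrt_mul hq]
    apply Real.sqrt_le_sqrt
    simp only [Real.norm_eq_abs, sq_abs]
    change ∑ i, ((Z * Y⁻¹).mulVec x.ofLp i) ^ 2 ≤ _
    rw [div_mul_eq_mul_div, le_div_iff₀ he]
    linarith
  calc specNorm (Z * Y⁻¹) ^ 2 ≤ Real.sqrt (ε ^ 2 / (1 - ε ^ 2)) ^ 2 :=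
        pow_le_pow_left₀ (norm_nonneg _) hb 2
    _ = _ := Real.sq_sqrt hq
end

section
/- Let T ∈ ℝ^{n×n} be symmetric with eigenvalues μ_1 ≤ … ≤ μ_n, let W_k ∈ ℝ^{n×k} have orthonormal columns with T·W_k = W_k·D_μ where D_μ = diag(μ_1, …, μ_k), and let E ∈ ℝ^{n×k} satisfy W_kᵀ·E = 0 and W_kᵀ·T·E = 0. Then Tr((I + Eᵀ·E)⁻¹·(D_μ + Eᵀ·T·E)) − (μ_1 + … + μ_k) ≤ k·(μ_n − μ_1)·‖(I + Eᵀ·E)⁻¹·Eᵀ·E‖, where ‖·‖ denotes the spectral norm. -/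
open Matrix

lemma aux_diag_le {k : ℕ} (A : Matrix (Fin k) (Fin k) ℝ) (i : Fin k) : A i i ≤ specNorm A := by
  have h := (LinearMap.toContinuousLinearMap (Matrix.toEuclideanLin A)).le_opNorm
    (EuclideanSpace.single i (1:ℝ))
  have h2 := PiLp.norm_apply_le ((LinearMap.toContinuousLinearMap (Matrix.toEuclideanLin A))
    (EuclideanSpace.single i (1:ℝ))) i
  have h3 : ((LinearMap.toContinuousLinearMap (Matrix.toEuclideanLin A))
    (EuclideanSpace.single i (1:ℝ))) i = A i i := by
    simp [Matrix.toLpLin_apply]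
  rw [h3] at h2
  simp only [EuclideanSpace.norm_single, norm_one, mul_one] at h
  exact (le_abs_self _).trans (h2.trans h)

open scoped MatrixOrder Matrix.Norms.L2Operator in
lemma aux_trace_nonneg {k : ℕ} (P X : Matrix (Fin k) (Fin k) ℝ) (hP : P.PosSemidef)
    (hX : X.PosSemidef) : 0 ≤ (P * X).trace := by
  obtain ⟨B, rfl⟩ := CStarAlgebra.nonneg_iff_eq_star_mul_self.mp hP.nonneg
  have h := (hX.mul_mul_conjTranspose_same B).trace_nonneg
  rw [Matrix.mul_assoc, Matrix.trace_mul_comm]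
  exact h

/-- trace estimate in the proof of Lemma 3.1.
`T` is symmetric with sorted eigenvalues `μ` (orthonormally diagonalized by `U`),
`W` has orthonormal columns with `T·W = W·D_μ`, `D_μ = diag(μ_1, …, μ_k)`, and
`E` satisfies `Wᵀ·E = 0` and `Wᵀ·T·E = 0`.  Then
`Tr((I + Eᵀ·E)⁻¹·(D_μ + Eᵀ·T·E)) − (μ_1 + ⋯ + μ_k)
  ≤ k·(μ_n − μ_1)·‖(I + Eᵀ·E)⁻¹·Eᵀ·E‖`. -/
theorem rayleigh_quotient_trace_estimate
    {n k : ℕ} (hn : 0 < n) (hk : k ≤ n)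
    (T : Matrix (Fin n) (Fin n) ℝ) (hT : Tᵀ = T)
    (μ : Fin n → ℝ) (hμ : Monotone μ)
    (U : Matrix (Fin n) (Fin n) ℝ) (hU : Uᵀ * U = 1)
    (hTdiag : T = U * Matrix.diagonal μ * Uᵀ)
    (W : Matrix (Fin n) (Fin k) ℝ) (hW : Wᵀ * W = 1)
    (hTW : T * W = W * Matrix.diagonal (fun i : Fin k => μ (Fin.castLE hk i)))
    (E : Matrix (Fin n) (Fin k) ℝ)
    (hWE : Wᵀ * E = 0) (hWTE : Wᵀ * T * E = 0) :
    Matrix.trace ((1 + Eᵀ * E)⁻¹ *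
        (Matrix.diagonal (fun i : Fin k => μ (Fin.castLE hk i)) + Eᵀ * T * E))
      - ∑ i : Fin k, μ (Fin.castLE hk i)
    ≤ (k : ℝ) * (μ ⟨n - 1, by omega⟩ - μ ⟨0, hn⟩) *
        specNorm ((1 + Eᵀ * E)⁻¹ * (Eᵀ * E)) := by
  set D := Matrix.diagonal (fun i : Fin k => μ (Fin.castLE hk i)) with hD
  set S := Eᵀ * E with hS
  set m := μ ⟨n - 1, by omega⟩ with hm
  set l := μ ⟨0, hn⟩ with hl
  have hSp : S.PosSemidef := by
    have := Matrix.posSemidef_conjTranspose_mul_self E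
    rwa [Matrix.conjTranspose_eq_transpose_of_trivial] at this
  have hM : (1 + S).PosDef := Matrix.PosDef.one.add_posSemidef hSp
  have hP : ((1 + S)⁻¹).PosDef := hM.inv
  have hdet : IsUnit (1 + S).det := (Matrix.isUnit_iff_isUnit_det _).mp hM.isUnit
  set P := (1 + S)⁻¹ with hPd
  have hPM : P * (1 + S) = 1 := Matrix.nonsing_inv_mul _ hdet
  have hMP : (1 + S) * P = 1 := Matrix.mul_nonsing_inv _ hdet
  have hPS : (P * S).PosSemidef := by
    have h1 : (S + Sᴴ * S).PosSemidef := hSp.add (Matrix.posSemidef_conjTranspose_mul_self S)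
    have h2 := h1.mul_mul_conjTranspose_same P
    have e : P * (S + Sᴴ * S) * Pᴴ = P * S := by
      rw [hP.isHermitian.eq, hSp.isHermitian.eq]
      calc P * (S + S * S) * P = P * S * ((1 + S) * P) := by noncomm_ring
        _ = P * S := by rw [hMP, mul_one]
    rwa [e] at h2
  have hUU : U * Uᵀ = 1 := mul_eq_one_comm.mp hU
  have hX : (m • S - Eᵀ * T * E).PosSemidef := by
    have h0 : (Matrix.diagonal (fun i => m - μ i)).PosSemidef := by
      apply Matrix.PosSemidef.diagonal
      intro i
      have : μ i ≤ m := hμ (Fin.mk_le_mk.mpr (by omega) : i ≤ ⟨n - 1, _⟩)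
      simpa using this
    have h1 := h0.mul_mul_conjTranspose_same (Eᵀ * U)
    have e : Eᵀ * U * (Matrix.diagonal (fun i => m - μ i)) * (Eᵀ * U)ᴴ
        = m • S - Eᵀ * T * E := by
      have ed : Matrix.diagonal (fun i => m - μ i) = m • 1 - Matrix.diagonal μ := by
        ext i j
        by_cases h : i = j <;> simp [h, Matrix.diagonal, Matrix.one_apply]
      rw [ed, hTdiag, Matrix.conjTranspose_eq_transpose_of_trivial, Matrix.transpose_mul,
        Matrix.transpose_transpose, Matrix.mul_sub, Matrix.sub_mul]
      congr 1
      · rw [Matrix.mul_smul, Matrix.smul_mul, Matrix.mul_one,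
          show Eᵀ * U * (Uᵀ * E) = Eᵀ * (U * Uᵀ) * E by simp only [Matrix.mul_assoc], hUU,
          Matrix.mul_one]
      · simp only [Matrix.mul_assoc]
    rwa [e] at h1
  have ht := aux_trace_nonneg P _ hP.posSemidef hX
  rw [Matrix.mul_sub, Matrix.trace_sub, Matrix.mul_smul, Matrix.trace_smul, smul_eq_mul] at ht
  have hPD : P * D = D - P * S * D := by
    have : D = P * (1 + S) * D := by rw [hPM, one_mul]
    rw [mul_add, mul_one, add_mul] at this
    exact eq_sub_of_add_eq this.symm
  have hDt : D.trace = ∑ i : Fin k, μ (Fin.castLE hk i) := by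
    rw [hD, Matrix.trace_diagonal]
  have hlow : l * (P * S).trace ≤ (P * S * D).trace := by
    simp only [Matrix.trace, Matrix.diag, hD, Matrix.mul_diagonal, Finset.mul_sum]
    apply Finset.sum_le_sum
    intro i _
    rw [mul_comm]
    exact mul_le_mul_of_nonneg_left (hμ (Fin.mk_le_mk.mpr (Nat.zero_le _))) hPS.diag_nonneg
  have hup : (P * S).trace ≤ k * specNorm (P * S) := by
    have := Finset.sum_le_sum (fun i (_ : i ∈ Finset.univ) => aux_diag_le (P * S) i)
    simpa [Matrix.trace] using this
  have hml : 0 ≤ m - l := sub_nonneg.mpr (hμ (Fin.mk_le_mk.mpr (Nat.zero_le _)))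
  rw [Matrix.mul_add, Matrix.trace_add, hPD, Matrix.trace_sub, hDt]
  have := mul_le_mul_of_nonneg_left hup hml
  nlinarith
end

section
/- Let T ∈ ℝ^{N×N} be symmetric with eigenvalues λ_1(T) ≤ … ≤ λ_N(T), and let W_k ∈ ℝ^{N×k} have orthonormal columns consisting of eigenvectors of T belonging to its smallest k eigenvalues. Let P ∈ ℝ^{N×ℓ} with Pᵀ·P = I and k ≤ ℓ, and suppose ‖W_k − P·Pᵀ·W_k‖ ≤ 2·tol for some 0 < tol < 1/2 (spectral norm). Then the eigenvalues of Pᵀ·T·P satisfy Σ_{i=1}^{k} (λ_i(Pᵀ·T·P) − λ_i(T)) ≤ 4·k·(λ_N(T) − λ_1(T))·tol². -/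
open Matrix

-- HELPERS
theorem aux_specNorm {n m : ℕ} (D : Matrix (Fin n) (Fin m) ℝ) (c : ℝ)
    (h : specNorm D ≤ c) (x : Fin m → ℝ) :
    (D *ᵥ x) ⬝ᵥ (D *ᵥ x) ≤ c ^ 2 * (x ⬝ᵥ x) := by
  have h1 := (LinearMap.toContinuousLinearMap (Matrix.toEuclideanLin D)).le_opNorm
    (WithLp.toLp 2 x)
  have h2 : ‖(LinearMap.toContinuousLinearMap (Matrix.toEuclideanLin D)) (WithLp.toLp 2 x)‖
      ≤ c * ‖WithLp.toLp 2 x‖ :=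
    h1.trans (mul_le_mul_of_nonneg_right h (norm_nonneg _))
  have h3 := pow_le_pow_left₀ (norm_nonneg _) h2 2
  rw [mul_pow, EuclideanSpace.norm_sq_eq, EuclideanSpace.norm_sq_eq] at h3
  simpa [dotProduct, pow_two] using h3

theorem aux_sum {ℓ k : ℕ} (hkℓ : k ≤ ℓ) (ν : Fin ℓ → ℝ) (hν : Monotone ν) (c : Fin ℓ → ℝ)
    (h0 : ∀ i, 0 ≤ c i) (h1 : ∀ i, c i ≤ 1) (hs : ∑ i, c i = k) :
    ∑ i : Fin k, ν (Fin.castLE hkℓ i) ≤ ∑ i, ν i * c i := by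
  obtain ⟨m, rfl⟩ := Nat.exists_eq_add_of_le hkℓ
  obtain ⟨t, ht1, ht2⟩ : ∃ t : ℝ, (∀ i : Fin k, ν (Fin.castAdd m i) ≤ t) ∧
      ∀ j : Fin m, t ≤ ν (Fin.natAdd k j) := by
    rcases Nat.eq_zero_or_pos k with rfl | hk
    · rcases Nat.eq_zero_or_pos m with rfl | hm
      · exact ⟨0, fun i => i.elim0, fun i => i.elim0⟩
      · refine ⟨ν (Fin.natAdd 0 ⟨0, hm⟩), fun i => i.elim0, fun j => hν ?_⟩
        simp [Fin.le_def]
    · refine ⟨ν (Fin.castAdd m ⟨k - 1, by omega⟩), fun i => hν ?_, fun j => hν ?_⟩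
      · simp [Fin.le_def]; omega
      · simp [Fin.le_def]; omega
  rw [Fin.sum_univ_add] at hs ⊢
  have a1 : ∑ i : Fin k, (ν (Fin.castAdd m i) - t) ≤
      ∑ i : Fin k, (ν (Fin.castAdd m i) - t) * c (Fin.castAdd m i) :=
    Finset.sum_le_sum fun i _ => by
      nlinarith [ht1 i, h1 (Fin.castAdd m i)]
  have a2 : 0 ≤ ∑ j : Fin m, (ν (Fin.natAdd k j) - t) * c (Fin.natAdd k j) :=
    Finset.sum_nonneg fun j _ => mul_nonneg (sub_nonneg.2 (ht2 j)) (h0 _)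
  simp only [sub_mul, Finset.sum_sub_distrib, ← Finset.mul_sum, Finset.sum_const,
    Finset.card_univ, Fintype.card_fin, nsmul_eq_mul] at a1 a2
  have e : ∑ i : Fin k, ν (Fin.castLE hkℓ i) = ∑ i : Fin k, ν (Fin.castAdd m i) := rfl
  rw [e]
  have : t * (∑ i : Fin k, c (Fin.castAdd m i)) + t * ∑ j : Fin m, c (Fin.natAdd k j)
    = k * t := by rw [← mul_add, hs, mul_comm]
  linarith

/-- Trace minimization against an orthogonal projector. -/
theorem aux_trace_min {ℓ k : ℕ} (hkℓ : k ≤ ℓ) (ν : Fin ℓ → ℝ) (hν : Monotone ν)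
    (V G : Matrix (Fin ℓ) (Fin ℓ) ℝ) (hV : Vᵀ * V = 1) (hG : Gᵀ = G) (hGG : G * G = G)
    (htr : G.trace = k) :
    ∑ i : Fin k, ν (Fin.castLE hkℓ i) ≤ (G * (V * Matrix.diagonal ν * Vᵀ)).trace := by
  have hV' : V * Vᵀ = 1 := mul_eq_one_comm.1 hV
  set H := Vᵀ * G * V with hH
  have hHt : Hᵀ = H := by simp [hH, hG, Matrix.mul_assoc]
  have hHH : H * H = H := by
    calc H * H = Vᵀ * G * (V * Vᵀ) * G * V := by simp only [hH, Matrix.mul_assoc]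
      _ = Vᵀ * (G * G) * V := by rw [hV', Matrix.mul_one]; simp only [Matrix.mul_assoc]
      _ = H := by rw [hGG]
  have hHtr : H.trace = k := by
    rw [hH, Matrix.trace_mul_comm, ← Matrix.mul_assoc, hV', Matrix.one_mul, htr]
  have hd : ∀ i, H i i = ∑ j, H i j ^ 2 := fun i => by
    conv_lhs => rw [← hHH]
    rw [Matrix.mul_apply]
    refine Finset.sum_congr rfl fun j _ => ?_
    have : H j i = H i j := congrFun (congrFun hHt i) j
    rw [this, pow_two]
  have h0 : ∀ i, 0 ≤ H i i := fun i => by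
    rw [hd]; exact Finset.sum_nonneg fun _ _ => sq_nonneg _
  have h1 : ∀ i, H i i ≤ 1 := fun i => by
    have : H i i ^ 2 ≤ H i i := by
      conv_rhs => rw [hd]
      exact Finset.single_le_sum (f := fun j => H i j ^ 2) (fun _ _ => sq_nonneg _)
        (Finset.mem_univ i)
    nlinarith [h0 i]
  refine (aux_sum hkℓ ν hν (fun i => H i i) h0 h1 hHtr).trans (le_of_eq ?_)
  have : (G * (V * Matrix.diagonal ν * Vᵀ)).trace = (Matrix.diagonal ν * H).trace := by
    rw [← Matrix.mul_assoc, Matrix.trace_mul_comm, ← Matrix.mul_assoc, ← Matrix.mul_assoc,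
      Matrix.trace_mul_comm, hH]
  rw [this]
  simp [Matrix.trace]

/-- single compression step estimate.
`T` is symmetric with sorted eigenvalues `lam` (orthonormally diagonalized by `U`), the
columns of `W` are orthonormal eigenvectors for the `k` smallest eigenvalues, `P` has
orthonormal columns with `k ≤ ℓ`, and `‖W − P·Pᵀ·W‖ ≤ 2·tol` with `0 < tol < 1/2`.
Then, `ν` denoting the sorted eigenvalues of `Pᵀ·T·P` (orthonormally diagonalized
by `V`), `Σ_{i<k} (ν_i − λ_i) ≤ 4·k·(λ_N − λ_1)·tol²`. -/
theorem single_compression_ritz_value_bound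
    {N ℓ k : ℕ} (hN : 0 < N) (hkℓ : k ≤ ℓ) (hℓN : ℓ ≤ N)
    (T : Matrix (Fin N) (Fin N) ℝ) (hT : Tᵀ = T)
    (lam : Fin N → ℝ) (hlam : Monotone lam)
    (U : Matrix (Fin N) (Fin N) ℝ) (hU : Uᵀ * U = 1)
    (hTdiag : T = U * Matrix.diagonal lam * Uᵀ)
    (W : Matrix (Fin N) (Fin k) ℝ) (hW : Wᵀ * W = 1)
    (hTW : T * W = W * Matrix.diagonal
        (fun i : Fin k => lam (Fin.castLE (hkℓ.trans hℓN) i)))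
    (P : Matrix (Fin N) (Fin ℓ) ℝ) (hP : Pᵀ * P = 1)
    (tol : ℝ) (htol0 : 0 < tol) (htol1 : tol < 1 / 2)
    (hWP : specNorm (W - P * Pᵀ * W) ≤ 2 * tol)
    (ν : Fin ℓ → ℝ) (hν : Monotone ν)
    (V : Matrix (Fin ℓ) (Fin ℓ) ℝ) (hV : Vᵀ * V = 1)
    (hPTP : Pᵀ * T * P = V * Matrix.diagonal ν * Vᵀ) :
    ∑ i : Fin k, (ν (Fin.castLE hkℓ i) - lam (Fin.castLE (hkℓ.trans hℓN) i))
      ≤ 4 * (k : ℝ) * (lam ⟨N - 1, by omega⟩ - lam ⟨0, hN⟩) * tol ^ 2 := by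
  set L := lam ⟨N - 1, by omega⟩ with hL
  set lk : Fin k → ℝ := fun i => lam (Fin.castLE (hkℓ.trans hℓN) i) with hlk
  have hLmax : ∀ i, lam i ≤ L := fun i => hlam (by simp only [Fin.le_def]; omega)
  have hmin : ∀ i, lam ⟨0, hN⟩ ≤ lam i := fun i => hlam (by simp [Fin.le_def])
  set M := Pᵀ * W with hM
  have hMt : Mᵀ = Wᵀ * P := by simp [hM]
  set B := Mᵀ * M with hB
  set D := W - P * Pᵀ * W with hD
  have hBt : Bᵀ = B := by simp [hB]
  have hDD : Dᵀ * D = 1 - B := by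
    have e1 : Dᵀ = Wᵀ - Wᵀ * P * Pᵀ := by simp [hD, Matrix.mul_assoc]
    have e2 : Wᵀ * P * Pᵀ * (P * Pᵀ * W) = B := by
      calc Wᵀ * P * Pᵀ * (P * Pᵀ * W) = Wᵀ * P * (Pᵀ * P) * (Pᵀ * W) := by
            simp only [Matrix.mul_assoc]
        _ = B := by rw [hP, Matrix.mul_one, hB, hMt]
    have e3 : Wᵀ * (P * Pᵀ * W) = B := by rw [hB, hMt, hM]; simp only [Matrix.mul_assoc]
    have e4 : Wᵀ * P * Pᵀ * W = B := by rw [hB, hMt, hM]; simp only [Matrix.mul_assoc]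
    rw [e1, hD, Matrix.mul_sub, Matrix.sub_mul, Matrix.sub_mul, hW, e2, e3, e4]
    abel
  have hquad : ∀ x : Fin k → ℝ, (D *ᵥ x) ⬝ᵥ (D *ᵥ x) = x ⬝ᵥ x - x ⬝ᵥ (B *ᵥ x) := fun x => by
    rw [Matrix.dotProduct_mulVec, ← Matrix.mulVec_transpose, Matrix.mulVec_mulVec, hDD,
      Matrix.sub_mulVec, Matrix.one_mulVec, sub_dotProduct, dotProduct_comm (B *ᵥ x)]
  have hDn := aux_specNorm D (2 * tol) hWP
  have hBu : IsUnit B := by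
    rw [← Matrix.mulVec_injective_iff_isUnit]
    rw [← Matrix.coe_mulVecLin, injective_iff_map_eq_zero]
    intro x hx
    have hx' : B *ᵥ x = 0 := hx
    have h1 := hDn x
    rw [hquad, hx', dotProduct_zero, sub_zero] at h1
    have h2 : 0 ≤ x ⬝ᵥ x := by
      simp only [dotProduct]; exact Finset.sum_nonneg fun i _ => mul_self_nonneg _
    have h3 : (2 * tol) ^ 2 < 1 := by nlinarith
    have h4 : x ⬝ᵥ x = 0 := by nlinarith
    exact dotProduct_self_eq_zero.1 h4
  have hBd : IsUnit B.det := (Matrix.isUnit_iff_isUnit_det B).1 hBu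
  have hBi : B⁻¹ * B = 1 := Matrix.nonsing_inv_mul B hBd
  set G := M * B⁻¹ * Mᵀ with hG
  have hGt : Gᵀ = G := by
    rw [hG]; simp only [Matrix.transpose_mul, Matrix.transpose_transpose,
      Matrix.transpose_nonsing_inv, hBt, Matrix.mul_assoc]
  have hMG : Mᵀ * G = Mᵀ := by
    rw [hG, ← Matrix.mul_assoc, ← Matrix.mul_assoc, ← hB, Matrix.mul_nonsing_inv B hBd,
      Matrix.one_mul]
  have hGG : G * G = G := by
    conv_lhs => lhs; rw [hG]
    rw [Matrix.mul_assoc, hMG]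
  have hGtr : G.trace = k := by
    rw [hG, Matrix.trace_mul_comm, ← Matrix.mul_assoc, ← hB, Matrix.mul_nonsing_inv B hBd]
    simp
  have hmain := aux_trace_min hkℓ ν hν V G hV hGt hGG hGtr
  rw [← hPTP] at hmain
  -- the shifted matrix
  set A : Matrix (Fin N) (Fin N) ℝ := L • 1 - T with hA
  have hU' : U * Uᵀ = 1 := mul_eq_one_comm.1 hU
  have hAd : A = U * Matrix.diagonal (fun i => L - lam i) * Uᵀ := by
    have : Matrix.diagonal (fun i => L - lam i) = L • (1 : Matrix (Fin N) (Fin N) ℝ)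
        - Matrix.diagonal lam := by
      rw [← Matrix.diagonal_one, ← Matrix.diagonal_smul, Matrix.diagonal_sub]
      congr 1; funext i; simp
    rw [this, Matrix.mul_sub, Matrix.sub_mul, ← hTdiag, hA]
    simp [hU']
  have hApsd : A.PosSemidef := by
    have h : (Matrix.diagonal (fun i => L - lam i)).PosSemidef :=
      Matrix.PosSemidef.diagonal (fun i => sub_nonneg.2 (hLmax i))
    have := h.mul_mul_conjTranspose_same U
    rwa [Matrix.conjTranspose_eq_transpose_of_trivial, ← hAd] at this
  have hAW : A * W = W * Matrix.diagonal (fun i => L - lk i) := by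
    have : Matrix.diagonal (fun i => L - lk i) = L • (1 : Matrix (Fin k) (Fin k) ℝ)
        - Matrix.diagonal lk := by
      rw [← Matrix.diagonal_one, ← Matrix.diagonal_smul, Matrix.diagonal_sub]
      congr 1; funext i; simp
    rw [this, hA, Matrix.sub_mul, Matrix.mul_sub, hTW]
    simp
  set Ak := Matrix.diagonal (fun i => L - lk i) with hAk
  have hAt : Aᵀ = A := by simp [hA, hT]
  have hWA : Wᵀ * A = Ak * Wᵀ := by
    have := congrArg Matrix.transpose hAW
    simpa [hAt, hAk] using this
  have hCpsd : (A - W * Ak * Wᵀ).PosSemidef := by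
    have h := hApsd.mul_mul_conjTranspose_same (1 - W * Wᵀ)
    rw [Matrix.conjTranspose_eq_transpose_of_trivial] at h
    convert h using 1
    have e1 : (1 - W * Wᵀ)ᵀ = 1 - W * Wᵀ := by simp
    have e2 : W * Wᵀ * A = W * Ak * Wᵀ := by rw [Matrix.mul_assoc, hWA, Matrix.mul_assoc]
    have e3 : A * (W * Wᵀ) = W * Ak * Wᵀ := by rw [← Matrix.mul_assoc, hAW]
    have e4 : W * Ak * Wᵀ * (W * Wᵀ) = W * Ak * Wᵀ := by
      calc W * Ak * Wᵀ * (W * Wᵀ) = W * Ak * (Wᵀ * W) * Wᵀ := by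
            simp only [Matrix.mul_assoc]
        _ = _ := by rw [hW, Matrix.mul_one]
    rw [e1, Matrix.sub_mul, Matrix.one_mul, e2, Matrix.mul_sub, Matrix.mul_one, Matrix.sub_mul,
      e3, e4]
    abel
  set Y := P * G with hY
  have hYt : Yᵀ = G * Pᵀ := by simp [hY, hGt]
  have hpos : 0 ≤ (Yᵀ * (A - W * Ak * Wᵀ) * Y).trace := by
    have := (hCpsd.conjTranspose_mul_mul_same Y).trace_nonneg
    rwa [Matrix.conjTranspose_eq_transpose_of_trivial] at this
  have hWY : Wᵀ * Y = Mᵀ := by rw [hY, ← Matrix.mul_assoc, ← hMt, hMG]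
  have hYW : Yᵀ * W = M := by
    have := congrArg Matrix.transpose hWY
    simpa using this
  have t1 : (Yᵀ * (W * Ak * Wᵀ) * Y).trace = ∑ i, (L - lk i) * B i i := by
    have : Yᵀ * (W * Ak * Wᵀ) * Y = M * Ak * Mᵀ := by
      rw [← hWY]; conv_rhs => rw [← hYW]
      simp only [Matrix.mul_assoc]
    rw [this, Matrix.mul_assoc, Matrix.trace_mul_comm, Matrix.mul_assoc, ← hB, hAk]
    simp [Matrix.trace]
  have t2 : (Yᵀ * A * Y).trace = k * L - (G * (Pᵀ * T * P)).trace := by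
    have hYY : Yᵀ * Y = G := by
      calc Yᵀ * Y = G * (Pᵀ * P) * G := by rw [hYt, hY]; simp only [Matrix.mul_assoc]
        _ = G := by rw [hP, Matrix.mul_one, hGG]
    have hYTY : (Yᵀ * T * Y).trace = (G * (Pᵀ * T * P)).trace := by
      calc (Yᵀ * T * Y).trace = (G * (Pᵀ * T * P) * G).trace := by
            rw [hYt, hY]; simp only [Matrix.mul_assoc]
        _ = _ := by rw [Matrix.trace_mul_comm, ← Matrix.mul_assoc, hGG]
    rw [hA, Matrix.mul_sub, Matrix.sub_mul, Matrix.trace_sub, hYTY]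
    simp [hYY, hGtr, mul_comm]
  rw [Matrix.mul_sub, Matrix.sub_mul, Matrix.trace_sub, t1, t2] at hpos
  have hBii : ∀ i, 1 - (2 * tol) ^ 2 ≤ B i i := fun i => by
    have h := hDn (Pi.single i 1)
    rw [hquad] at h
    simp at h
    linarith
  have hfin : ∑ i, (L - lk i) * (1 - B i i) ≤
      ∑ _i : Fin k, (L - lam ⟨0, hN⟩) * (2 * tol) ^ 2 :=
    Finset.sum_le_sum fun i _ => by
      have h1 : 0 ≤ L - lk i := sub_nonneg.2 (hLmax _)
      have h2 : lam ⟨0, hN⟩ ≤ lk i := hmin _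
      calc (L - lk i) * (1 - B i i) ≤ (L - lk i) * (2 * tol) ^ 2 :=
            mul_le_mul_of_nonneg_left (by linarith [hBii i]) h1
        _ ≤ _ := mul_le_mul_of_nonneg_right (by linarith) (sq_nonneg _)
  simp only [mul_sub, mul_one, Finset.sum_sub_distrib, Finset.sum_const, Finset.card_univ,
    Fintype.card_fin, nsmul_eq_mul] at hfin ⊢
  have : ∑ i : Fin k, lam (Fin.castLE (hkℓ.trans hℓN) i) = ∑ i, lk i := rfl
  nlinarith
end

section
/- Let T ∈ ℝ^{m×m} be symmetric with orthonormal eigenvectors s_1, …, s_m and eigenvalues θ_1, …, θ_m, i.e., T·s_i = θ_i·s_i. Let p, q be real polynomials with q(θ_i) ≠ 0 for all i, and set r(T) := p(T)·q(T)⁻¹. Let V ∈ ℝ^{m×ℓ} satisfy Vᵀ·V = I and s_i ∈ range(V) for i = 1, …, k̂. Then for every v ∈ ℝ^m, ‖(I − V·Vᵀ)·r(T)·v‖ ≤ ‖v‖ · max_{k̂+1 ≤ i ≤ m} |p(θ_i)/q(θ_i)| (Euclidean norms). -/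
open Matrix Polynomial

lemma aux_eig {m : ℕ} (T : Matrix (Fin m) (Fin m) ℝ) (x : Fin m → ℝ) (a : ℝ)
    (h : T.mulVec x = a • x) (p : Polynomial ℝ) :
    (Polynomial.aeval T p).mulVec x = p.eval a • x := by
  induction p using Polynomial.induction_on' with
  | add p q hp hq => simp [Matrix.add_mulVec, hp, hq, add_smul]
  | monomial n c =>
    have hn : (T ^ n).mulVec x = a ^ n • x := by
      induction n with
      | zero => simp
      | succ n ih =>
        rw [pow_succ, ← Matrix.mulVec_mulVec, h, Matrix.mulVec_smul, ih, smul_smul, pow_succ,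
          mul_comm]
    rw [Polynomial.aeval_monomial, ← Algebra.smul_def, Matrix.smul_mulVec, hn, smul_smul,
      Polynomial.eval_monomial]

lemma aux_diag {m : ℕ} (T : Matrix (Fin m) (Fin m) ℝ) (s : Fin m → Fin m → ℝ) (θ : Fin m → ℝ)
    (heig : ∀ i, T.mulVec (s i) = θ i • s i) (p : Polynomial ℝ) :
    (Polynomial.aeval T p) * (Matrix.of s)ᵀ =
      (Matrix.of s)ᵀ * Matrix.diagonal (fun i => p.eval (θ i)) := by
  ext a i
  rw [Matrix.mul_diagonal]
  have := congrFun (aux_eig T (s i) (θ i) (heig i) p) a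
  simp only [Pi.smul_apply, smul_eq_mul] at this
  rw [Matrix.transpose_apply, Matrix.of_apply, mul_comm (s i a), ← this]
  rfl

lemma aux_sq {m : ℕ} (x : Fin m → ℝ) : ∑ j, (x j) ^ 2 = x ⬝ᵥ x := by
  simp [dotProduct, sq]

lemma aux_iso {m n : ℕ} (A : Matrix (Fin n) (Fin m) ℝ) (hA : Aᵀ * A = 1) (x : Fin m → ℝ) :
    (A.mulVec x) ⬝ᵥ (A.mulVec x) = x ⬝ᵥ x := by
  rw [Matrix.dotProduct_mulVec, Matrix.vecMul_mulVec, hA, Matrix.vecMul_one]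

lemma aux_proj {m l : ℕ} (V : Matrix (Fin m) (Fin l) ℝ) (hV : Vᵀ * V = 1) (w : Fin m → ℝ) :
    ((1 - V * Vᵀ).mulVec w) ⬝ᵥ ((1 - V * Vᵀ).mulVec w) ≤ w ⬝ᵥ w := by
  have h1 : (1 - V * Vᵀ).mulVec w = w - V.mulVec (Vᵀ.mulVec w) := by
    rw [Matrix.sub_mulVec, Matrix.one_mulVec, Matrix.mulVec_mulVec]
  have h2 : w ⬝ᵥ (V.mulVec (Vᵀ.mulVec w)) = (Vᵀ.mulVec w) ⬝ᵥ (Vᵀ.mulVec w) := by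
    rw [Matrix.dotProduct_mulVec, Matrix.mulVec_transpose]
  have h3 := aux_iso V hV (Vᵀ.mulVec w)
  have h4 : 0 ≤ (Vᵀ.mulVec w) ⬝ᵥ (Vᵀ.mulVec w) := by
    rw [← aux_sq]; positivity
  rw [h1, sub_dotProduct, dotProduct_sub, dotProduct_sub, h3, h2,
    dotProduct_comm (V.mulVec (Vᵀ.mulVec w)) w, h2]
  linarith

/-- the complement of `range V` captures little of `r(T)·v`.
`T` is symmetric with orthonormal eigenvectors `s i` and eigenvalues `θ i`; `q` does not
vanish on the spectrum; `V` has orthonormal columns and its range contains the first `k̂`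
eigenvectors.  Then for every `v`,
`‖(I − V·Vᵀ)·r(T)·v‖ ≤ ‖v‖ · max_{k̂+1 ≤ i ≤ m} |p(θ_i)/q(θ_i)|`
(Euclidean norms), where `r(T) = p(T)·q(T)⁻¹` and, in the 0-based encoding, the maximum
ranges over the indices `i` with `k̂ ≤ i < m`. -/
theorem complement_of_range_captures_little
    {m ℓ khat : ℕ} (hkm : khat < m)
    (T : Matrix (Fin m) (Fin m) ℝ) (hT : Tᵀ = T)
    (s : Fin m → Fin m → ℝ) (θ : Fin m → ℝ)
    (horth : ∀ i j, s i ⬝ᵥ s j = if i = j then (1 : ℝ) else 0)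
    (heig : ∀ i, T.mulVec (s i) = θ i • s i)
    (p q : Polynomial ℝ) (hq : ∀ i, q.eval (θ i) ≠ 0)
    (V : Matrix (Fin m) (Fin ℓ) ℝ) (hV : Vᵀ * V = 1)
    (hrange : ∀ i : Fin khat, s (Fin.castLE hkm.le i) ∈ LinearMap.range V.mulVecLin)
    (v : Fin m → ℝ) :
    Real.sqrt (∑ j, (((1 - V * Vᵀ).mulVec
          (((Polynomial.aeval T) p * ((Polynomial.aeval T) q)⁻¹).mulVec v)) j) ^ 2)
      ≤ Real.sqrt (∑ j, (v j) ^ 2) *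
        (Finset.Ici (⟨khat, hkm⟩ : Fin m)).sup' ⟨⟨khat, hkm⟩, Finset.mem_Ici.mpr le_rfl⟩
          (fun i => |p.eval (θ i) / q.eval (θ i)|) := by
  set M := (Finset.Ici (⟨khat, hkm⟩ : Fin m)).sup' ⟨⟨khat, hkm⟩, Finset.mem_Ici.mpr le_rfl⟩
          (fun i => |p.eval (θ i) / q.eval (θ i)|) with hM
  have hMi : ∀ i : Fin m, khat ≤ i.1 → |p.eval (θ i) / q.eval (θ i)| ≤ M := by
    intro i hi
    exact Finset.le_sup' (fun i => |p.eval (θ i) / q.eval (θ i)|)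
      (Finset.mem_Ici.mpr (show (⟨khat, hkm⟩ : Fin m) ≤ i from hi))
  have hM0 : 0 ≤ M := (abs_nonneg _).trans (hMi ⟨khat, hkm⟩ le_rfl)
  set S : Matrix (Fin m) (Fin m) ℝ := Matrix.of s with hS
  have hSS : S * Sᵀ = 1 := by
    ext i j
    rw [Matrix.one_apply, ← horth i j]
    rfl
  have hSS' : Sᵀ * S = 1 := mul_eq_one_comm.mp hSS
  have hpd := aux_diag T s θ heig p
  have hqd := aux_diag T s θ heig q
  rw [← hS] at hpd hqd
  have hinv : (Polynomial.aeval T q)⁻¹ =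
      Sᵀ * Matrix.diagonal (fun i => (q.eval (θ i))⁻¹) * S := by
    apply Matrix.inv_eq_right_inv
    rw [← Matrix.mul_assoc, ← Matrix.mul_assoc, hqd, Matrix.mul_assoc Sᵀ,
      Matrix.diagonal_mul_diagonal]
    simp [hq, hSS']
  have hr : Polynomial.aeval T p * (Polynomial.aeval T q)⁻¹ =
      Sᵀ * Matrix.diagonal (fun i => p.eval (θ i) / q.eval (θ i)) * S := by
    rw [hinv, ← Matrix.mul_assoc, ← Matrix.mul_assoc, hpd, Matrix.mul_assoc Sᵀ,
      Matrix.diagonal_mul_diagonal]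
    simp [div_eq_mul_inv]
  set c := S.mulVec v with hc
  let d : Fin m → ℝ := fun i => if khat ≤ i.1 then p.eval (θ i) / q.eval (θ i) * c i else 0
  have hPs : ∀ i : Fin m, i.1 < khat → (1 - V * Vᵀ).mulVec (s i) = 0 := by
    intro i hi
    obtain ⟨y, hy⟩ := hrange ⟨i.1, hi⟩
    have hy' : V.mulVec y = s i := hy
    rw [← hy', Matrix.mulVec_mulVec, Matrix.sub_mul, Matrix.mul_assoc, hV]
    simp
  have hPS : ∀ x : Fin m → ℝ, (1 - V * Vᵀ).mulVec (Sᵀ.mulVec x) =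
      ∑ i, x i • (1 - V * Vᵀ).mulVec (s i) := by
    intro x
    have : Sᵀ.mulVec x = ∑ i, x i • s i := by
      ext a
      simp [Matrix.mulVec, dotProduct, hS, mul_comm]
    rw [this, Matrix.mulVec_sum]
    simp [Matrix.mulVec_smul]
  have hkey : (1 - V * Vᵀ).mulVec
      ((Polynomial.aeval T p * (Polynomial.aeval T q)⁻¹).mulVec v) =
      (1 - V * Vᵀ).mulVec (Sᵀ.mulVec d) := by
    rw [hr, ← Matrix.mulVec_mulVec, ← Matrix.mulVec_mulVec, ← hc, hPS, hPS]
    refine Finset.sum_congr rfl fun i _ => ?_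
    by_cases hi : khat ≤ i.1
    · simp only [Matrix.mulVec_diagonal, d, if_pos hi]
    · rw [hPs i (not_le.mp hi), smul_zero, smul_zero]
  rw [hkey]
  have hb : ∑ j, (((1 - V * Vᵀ).mulVec (Sᵀ.mulVec d)) j) ^ 2 ≤ (∑ j, (v j) ^ 2) * M ^ 2 := by
    rw [aux_sq]
    refine (aux_proj V hV _).trans ?_
    rw [aux_iso Sᵀ (by rw [Matrix.transpose_transpose]; exact hSS), aux_sq,
      ← aux_iso S hSS' v, ← hc, ← aux_sq, ← aux_sq, Finset.sum_mul]
    refine Finset.sum_le_sum fun i _ => ?_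
    by_cases hi : khat ≤ i.1
    · simp only [d, if_pos hi]
      rw [mul_pow, mul_comm]
      refine mul_le_mul_of_nonneg_left ?_ (sq_nonneg _)
      rw [← sq_abs]
      exact pow_le_pow_left₀ (abs_nonneg _) (hMi i hi) 2
    · simp only [d, if_neg hi]
      rw [zero_pow two_ne_zero]; positivity
  calc _ ≤ Real.sqrt ((∑ j, (v j) ^ 2) * M ^ 2) := Real.sqrt_le_sqrt hb
    _ = _ := by rw [Real.sqrt_mul (by positivity), Real.sqrt_sq hM0]
end
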